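/- arXiv:2410.12861 — 4 statements merged into one kernel-verified Lean document; each statement's English description precedes it below -/
import Mathlib

section
/- Let n be a natural number with n ≥ 2, let x : Fin n → ℝ have a strict maximum at index k, and let j ≠ k. Then softmax(x/τ)_j = exp(x_j/τ) / ∑_i exp(x_i/τ) tends to 0 as τ → 0⁺. (Complement of the low-temperature concentration claim: at low temperature all attention mass away from the maximal similarity score vanishes.) -/
open Real Filter

/-- The softmax mass at `j` is at most the ratio of the exponentials at `j` and `k`. -/
theorem exp_div_sum_exp_le_exp_sub {ι : Type*} [Fintype ι] (y : ι → ℝ) (j k : ι) :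
    Real.exp (y j) / ∑ i, Real.exp (y i) ≤ Real.exp (y j - y k) := by
  rw [Real.exp_sub]
  gcongr
  exact Finset.single_le_sum (f := fun i => Real.exp (y i)) (fun i _ => (Real.exp_pos _).le)
    (Finset.mem_univ k)

/-- As `τ → 0⁺`, the temperature-scaled softmax mass away from the strict maximum vanishes. -/
theorem softmax_low_temp_tendsto_zero_off_max (n : ℕ) (hn : 2 ≤ n) (x : Fin n → ℝ)
    (k : Fin n) (hk : ∀ j, j ≠ k → x j < x k) (j : Fin n) (hj : j ≠ k) :
    Tendsto
      (fun τ : ℝ => Real.exp (x j / τ) / ∑ i, Real.exp (x i / τ))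
      (nhdsWithin 0 (Set.Ioi 0)) (nhds 0) := by
  have h_exp : Tendsto (fun τ : ℝ => Real.exp ((x j - x k) * τ⁻¹))
      (nhdsWithin 0 (Set.Ioi 0)) (nhds 0) :=
    Real.tendsto_exp_atBot.comp
      (tendsto_inv_nhdsGT_zero.const_mul_atTop_of_neg (sub_neg.mpr (hk j hj)))
  refine squeeze_zero (fun τ => by positivity) (fun τ => ?_) h_exp
  rw [← div_eq_mul_inv, sub_div]
  exact exp_div_sum_exp_le_exp_sub (fun i => x i / τ) j k
end

section
/- Let n be a positive natural number, let x : Fin n → ℝ, and let k be an index attaining the maximum of x (x_j ≤ x_k for all j). Then the function τ ↦ softmax(x/τ)_k is antitone on (0, ∞): for 0 < τ₁ ≤ τ₂ one has softmax(x/τ₂)_k ≤ softmax(x/τ₁)_k. (This makes precise the paper's Lemma 'Effect of Temperature on Attention Distribution': the sharpness of the attention distribution is inversely related to τ — lower τ gives sharper attention on the dominant token.) -/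
open Real Filter

/-- The temperature-scaled softmax weight of a maximal coordinate is antitone in the
temperature on `(0, ∞)`: lower temperature gives sharper attention on the dominant token. -/
theorem softmax_max_coord_antitoneOn (n : ℕ) (hn : 0 < n) (x : Fin n → ℝ) (k : Fin n)
    (hk : ∀ j, x j ≤ x k) :
    AntitoneOn
      (fun τ : ℝ => Real.exp (x k / τ) / ∑ j, Real.exp (x j / τ))
      (Set.Ioi (0 : ℝ)) := by
  intro a ha b _ hab
  have : Nonempty (Fin n) := ⟨k⟩
  have sum_pos (τ : ℝ) : 0 < ∑ j, Real.exp (x j / τ) :=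
    Finset.sum_pos (fun j _ => Real.exp_pos _) Finset.univ_nonempty
  refine (div_le_div_iff₀ (sum_pos b) (sum_pos a)).2 ?_
  rw [Finset.mul_sum, Finset.mul_sum]
  refine Finset.sum_le_sum fun j _ => ?_
  rw [← Real.exp_add, ← Real.exp_add, Real.exp_le_exp]
  have h : (x k - x j) / b ≤ (x k - x j) / a :=
    div_le_div_of_nonneg_left (sub_nonneg.2 (hk j)) ha hab
  rw [sub_div, sub_div] at h
  linarith
end

section
/- Let n be a positive natural number, let x : Fin n → ℝ, and let m be an index attaining the minimum of x (x_m ≤ x_j for all j). Then the function τ ↦ softmax(x/τ)_m is monotone on (0, ∞): for 0 < τ₁ ≤ τ₂ one has softmax(x/τ₁)_m ≤ softmax(x/τ₂)_m. (Dual form of the paper's Lemma on the effect of temperature: higher τ distributes attention more uniformly, raising the weight of the least similar token.) -/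
open Real Filter

/-- The temperature-scaled softmax weight of a minimal coordinate is monotone in the
temperature on `(0, ∞)`: higher temperature raises the weight of the least similar token. -/
theorem softmax_min_coord_monotoneOn (n : ℕ) (hn : 0 < n) (x : Fin n → ℝ) (m : Fin n)
    (hm : ∀ j, x m ≤ x j) :
    MonotoneOn
      (fun τ : ℝ => Real.exp (x m / τ) / ∑ j, Real.exp (x j / τ))
      (Set.Ioi (0 : ℝ)) := by
  intro s hs t ht hst
  rw [Set.mem_Ioi] at hs
  have sum_pos (τ : ℝ) : 0 < ∑ j, Real.exp (x j / τ) :=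
    Finset.sum_pos (fun _ _ => Real.exp_pos _) ⟨m, Finset.mem_univ m⟩
  change Real.exp (x m / s) / _ ≤ Real.exp (x m / t) / _
  rw [div_le_div_iff₀ (sum_pos s) (sum_pos t), Finset.mul_sum, Finset.mul_sum]
  refine Finset.sum_le_sum fun j _ => ?_
  rw [← Real.exp_add, ← Real.exp_add, Real.exp_le_exp]
  have h : (x j - x m) / t ≤ (x j - x m) / s :=
    div_le_div_of_nonneg_left (sub_nonneg.2 (hm j)) hs hst
  rw [sub_div, sub_div] at h
  linarith
end

section
/- Let n be a natural number with n ≥ 2, let x : Fin n → ℝ, and fix an index i. Then as t → −∞: (a) softmax(update x i t)_i = exp(t) / (exp(t) + ∑_{j ≠ i} exp(x_j)) tends to 0, and (b) for each j ≠ i, softmax(update x i t)_j tends to exp(x_j) / ∑_{k ≠ i} exp(x_k). (This is the paper's inter-token relation enhancement mechanism: setting the diagonal entry S_ii to −∞ drives A_ii to 0 and redistributes the attention among the other tokens.) -/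
open Real Filter

/-- Setting the diagonal entry to `−∞` drives `A_ii` to `0` and redistributes attention
among the other tokens. -/
theorem softmax_diag_mask_limits (n : ℕ) (hn : 2 ≤ n) (x : Fin n → ℝ) (i : Fin n) :
    Tendsto
      (fun t : ℝ =>
        Real.exp t / (Real.exp t + ∑ k ∈ Finset.univ.erase i, Real.exp (x k)))
      atBot (nhds 0) ∧
    ∀ j : Fin n, j ≠ i →
      Tendsto
        (fun t : ℝ =>
          Real.exp (x j) / (Real.exp t + ∑ k ∈ Finset.univ.erase i, Real.exp (x k)))
        atBot
        (nhds (Real.exp (x j) / ∑ k ∈ Finset.univ.erase i, Real.exp (x k))) := by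
  have hsum : 0 < ∑ k ∈ Finset.univ.erase i, Real.exp (x k) := by
    refine Finset.sum_pos (fun k _ => Real.exp_pos _) ?_
    rw [← Finset.card_pos, Finset.card_erase_of_mem (Finset.mem_univ i), Finset.card_fin]
    omega
  have hden : Tendsto
      (fun t : ℝ => Real.exp t + ∑ k ∈ Finset.univ.erase i, Real.exp (x k)) atBot
      (nhds (∑ k ∈ Finset.univ.erase i, Real.exp (x k))) := by
    simpa using Real.tendsto_exp_atBot.add_const (∑ k ∈ Finset.univ.erase i, Real.exp (x k))
  refine ⟨?_, fun j _ => tendsto_const_nhds.div hden hsum.ne'⟩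
  have h := Real.tendsto_exp_atBot.div hden hsum.ne'
  rwa [zero_div] at h
end
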